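/- Let n ≥ 1, 1 ≤ p < ∞, 0 < T < ∞, let i ≥ 0 be an integer, and let (φ′,ψ′) be a Littlewood–Paley family on ℝⁿ. There exists C > 0 (depending only on n, p, T, i, φ′, ψ′) such that for every Schwartz function f on ℝⁿ, the heat extension u(X,t) = (Γ(·,t)*f)(X) satisfies B_{2i−2/p, p}(f) ≤ C·‖u‖_{W^{2i,i}_p(ℝⁿ_T)}. -/

import Mathlib

noncomputable section

open MeasureTheory Real Complex
open scoped ENNReal NNReal Real BigOperators

/-- Euclidean space `ℝⁿ`. -/
abbrev Rn (n : ℕ) : Type := EuclideanSpace ℝ (Fin n)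

/-- The space `ℝ^{n+1} = ℝⁿ × ℝ`, points written `(X, t)`. -/
abbrev Rn1 (n : ℕ) : Type := EuclideanSpace ℝ (Fin n) × ℝ

/-- Fourier transform on `ℝ^{n+1}`:
`𝓕f(ξ,τ) = ∫ e^{−2πi(X·ξ + tτ)} f(X,t) dX dt`. -/
def FT1 {n : ℕ} (f : Rn1 n → ℂ) (q : Rn1 n) : ℂ :=
  ∫ p : Rn1 n,
    Complex.exp (-(2 * (π : ℂ) * Complex.I) *
      (((∑ k, p.1 k * q.1 k) + p.2 * q.2 : ℝ) : ℂ)) * f p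

/-- Inverse Fourier transform on `ℝ^{n+1}`. -/
def IFT1 {n : ℕ} (f : Rn1 n → ℂ) (x : Rn1 n) : ℂ :=
  ∫ q : Rn1 n,
    Complex.exp ((2 * (π : ℂ) * Complex.I) *
      (((∑ k, q.1 k * x.1 k) + q.2 * x.2 : ℝ) : ℂ)) * f q

/-- The Fourier multiplier operator `f ↦ 𝓕⁻¹(m · 𝓕 f)` on `ℝ^{n+1}`. -/
def MOp {n : ℕ} (m : Rn1 n → ℂ) (f : Rn1 n → ℂ) : Rn1 n → ℂ :=
  IFT1 (fun q => m q * FT1 f q)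

/-- The symbol `m_α(ξ,τ) = (1 + 4π²|ξ|² + iτ)^{α/2}` (principal branch). -/
def mSym {n : ℕ} (α : ℝ) (q : Rn1 n) : ℂ :=
  (1 + 4 * (π : ℂ) ^ 2 * (‖q.1‖ : ℂ) ^ 2 + Complex.I * (q.2 : ℂ)) ^ ((α : ℂ) / 2)

/-- Partial derivative `∂_{X_k}`. -/
def dX {n : ℕ} (k : Fin n) (f : Rn1 n → ℂ) : Rn1 n → ℂ :=
  fun x => fderiv ℝ f x (EuclideanSpace.single k 1, 0)

/-- Partial derivative `∂_t`. -/
def dT {n : ℕ} (f : Rn1 n → ℂ) : Rn1 n → ℂ :=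
  fun x => fderiv ℝ f x (0, 1)

/-- Iterated spatial derivative `D_X^β` for a multi-index `β`. -/
def dXmulti {n : ℕ} (β : Fin n → ℕ) (f : Rn1 n → ℂ) : Rn1 n → ℂ :=
  (List.finRange n).foldr (fun k g => (dX k)^[β k] g) f

/-- The half time-derivative `D_t^{1/2} f = 𝓕⁻¹(|τ|^{1/2}·𝓕f)`. -/
def halfDt {n : ℕ} (f : Rn1 n → ℂ) : Rn1 n → ℂ :=
  MOp (fun q => ((|q.2| ^ ((1 : ℝ) / 2) : ℝ) : ℂ)) f

/-- The `Lᵖ(ℝ^{n+1})` norm (as a value in `ℝ≥0∞`), `p` a real exponent. -/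
def pNorm {n : ℕ} (p : ℝ) (f : Rn1 n → ℂ) : ℝ≥0∞ :=
  eLpNorm f (ENNReal.ofReal p) volume

/-- Multi-indices `β ∈ ℕⁿ` with `|β| = N`. -/
def multiIdx (n N : ℕ) : Finset (Fin n → ℕ) :=
  (Fintype.piFinset fun _ : Fin n => Finset.range (N + 1)).filter fun β => (∑ k, β k) = N

/-- Convolution on `ℝ^{n+1}`. -/
def conv1 {n : ℕ} (g f : Rn1 n → ℂ) : Rn1 n → ℂ :=
  fun x => ∫ y : Rn1 n, g (x - y) * f y

/-- A parabolic Littlewood–Paley family on `ℝ^{n+1}`. -/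
structure ParabolicLP (n : ℕ) where
  φ : SchwartzMap (Rn1 n) ℂ
  ψ : SchwartzMap (Rn1 n) ℂ
  ft_pos : ∀ q : Rn1 n,
    1 / 2 < ‖q.1‖ + |q.2| ^ ((1 : ℝ) / 2) → ‖q.1‖ + |q.2| ^ ((1 : ℝ) / 2) < 2 →
      0 < (FT1 (⇑φ) q).re ∧ (FT1 (⇑φ) q).im = 0
  ft_supp : ∀ q : Rn1 n,
    ¬(1 / 2 < ‖q.1‖ + |q.2| ^ ((1 : ℝ) / 2) ∧ ‖q.1‖ + |q.2| ^ ((1 : ℝ) / 2) < 2) →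
      FT1 (⇑φ) q = 0
  ft_sum : ∀ q : Rn1 n, q ≠ 0 →
    ∑' i : ℤ, FT1 (⇑φ) (((2 : ℝ) ^ (-i)) • q.1, ((2 : ℝ) ^ (-(2 * i))) * q.2) = 1
  ft_psi : ∀ q : Rn1 n,
    FT1 (⇑ψ) q =
      1 - ∑' i : ℕ,
        FT1 (⇑φ) (((2 : ℝ) ^ (-((i : ℤ) + 1))) • q.1, ((2 : ℝ) ^ (-(2 * ((i : ℤ) + 1)))) * q.2)

/-- The dilate `φ_i`, whose Fourier transform is `𝓕φ(2^{−i}ξ, 2^{−2i}τ)`. -/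
def lpPhi {n : ℕ} (P : ParabolicLP n) (i : ℕ) : Rn1 n → ℂ :=
  fun x => (((2 : ℝ) ^ (i * (n + 2)) : ℝ) : ℂ) *
    P.φ (((2 : ℝ) ^ i) • x.1, ((2 : ℝ) ^ (2 * i)) * x.2)

/-- Parabolic Besov norm `N_{s,p}(f)` on `ℝ^{n+1}`, `1 ≤ p < ∞`. -/
def pBesov {n : ℕ} (P : ParabolicLP n) (s p : ℝ) (f : Rn1 n → ℂ) : ℝ≥0∞ :=
  eLpNorm (conv1 (⇑P.ψ) f) (ENNReal.ofReal p) volume +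
  (∑' i : ℕ,
    (ENNReal.ofReal ((2 : ℝ) ^ (s * ((i : ℝ) + 1))) *
      eLpNorm (conv1 (lpPhi P (i + 1)) f) (ENNReal.ofReal p) volume) ^ p) ^ (1 / p)

/-- Parabolic Besov norm `N_{s,∞}(f)` on `ℝ^{n+1}`. -/
def pBesovInf {n : ℕ} (P : ParabolicLP n) (s : ℝ) (f : Rn1 n → ℂ) : ℝ≥0∞ :=
  max (eLpNorm (conv1 (⇑P.ψ) f) ⊤ volume)
    (⨆ i : ℕ, ENNReal.ofReal ((2 : ℝ) ^ (s * ((i : ℝ) + 1))) *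
      eLpNorm (conv1 (lpPhi P (i + 1)) f) ⊤ volume)

/-- The time interval `(0, T)` for `0 < T ≤ ∞`. -/
def tSet (T : ℝ≥0∞) : Set ℝ := {t : ℝ | 0 < t ∧ ENNReal.ofReal t < T}

/-- Lebesgue measure restricted to the strip `ℝⁿ × (0,T)`. -/
def stripMeasure (n : ℕ) (T : ℝ≥0∞) : Measure (Rn1 n) :=
  volume.restrict {x : Rn1 n | x.2 ∈ tSet T}

/-- The parabolic Sobolev norm `‖g‖_{W^{2i,i}_p(ℝⁿ_T)}`. -/
def wNorm {n : ℕ} (i : ℕ) (p : ℝ) (T : ℝ≥0∞) (g : Rn1 n → ℂ) : ℝ≥0∞ :=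
  ∑ l ∈ Finset.range (i + 1),
    ∑ β ∈ (Fintype.piFinset fun _ : Fin n => Finset.range (2 * i + 1)).filter
        (fun β => (∑ k, β k) + 2 * l ≤ 2 * i),
      eLpNorm (dXmulti β (dT^[l] g)) (ENNReal.ofReal p) (stripMeasure n T)

/-- Time-regularity seminorm `[g]_{t,β,p,T}`. -/
def semT {n : ℕ} (b p : ℝ) (T : ℝ≥0∞) (g : Rn1 n → ℂ) : ℝ≥0∞ :=
  (∫⁻ X : Rn n, ∫⁻ t in tSet T, ∫⁻ s in tSet T,
      ENNReal.ofReal (‖g (X, t) - g (X, s)‖ ^ p / |t - s| ^ (1 + p * b / 2))) ^ (1 / p)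

/-- Space-regularity seminorm `[g]_{x,β,p,T}`. -/
def semX {n : ℕ} (b p : ℝ) (T : ℝ≥0∞) (g : Rn1 n → ℂ) : ℝ≥0∞ :=
  (∫⁻ t in tSet T, ∫⁻ X : Rn n, ∫⁻ Y : Rn n,
      ENNReal.ofReal (‖g (X + Y, t) - 2 * g (X, t) + g (X - Y, t)‖ ^ p /
        ‖Y‖ ^ ((n : ℝ) + p * b))) ^ (1 / p)

/-- The parabolic Besov norm `‖g‖_{B^{α,α/2}_p(ℝⁿ_T)}`, formed with index `i` where
`2i < α < 2i+2`. -/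
def pbNorm {n : ℕ} (i : ℕ) (α p : ℝ) (T : ℝ≥0∞) (g : Rn1 n → ℂ) : ℝ≥0∞ :=
  wNorm i p T g +
  ∑ l ∈ Finset.range (i + 1),
    ∑ β ∈ (Fintype.piFinset fun _ : Fin n => Finset.range (2 * i + 1)).filter
        (fun β => (∑ k, β k) + 2 * l = 2 * i),
      (semT (α - 2 * i) p T (dXmulti β (dT^[l] g)) +
        semX (α - 2 * i) p T (dXmulti β (dT^[l] g)))

/-- Fourier transform on `ℝⁿ`. -/
def FTn {n : ℕ} (f : Rn n → ℂ) (ξ : Rn n) : ℂ :=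
  ∫ x : Rn n, Complex.exp (-(2 * (π : ℂ) * Complex.I) * (((∑ k, x k * ξ k : ℝ)) : ℂ)) * f x

/-- Inverse Fourier transform on `ℝⁿ`. -/
def IFTn {n : ℕ} (f : Rn n → ℂ) (x : Rn n) : ℂ :=
  ∫ ξ : Rn n, Complex.exp ((2 * (π : ℂ) * Complex.I) * (((∑ k, ξ k * x k : ℝ)) : ℂ)) * f ξ

/-- Convolution on `ℝⁿ`. -/
def convn {n : ℕ} (g f : Rn n → ℂ) : Rn n → ℂ := fun x => ∫ y : Rn n, g (x - y) * f y

/-- A Littlewood–Paley family on `ℝⁿ`. -/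
structure LPFamily (n : ℕ) where
  φ : SchwartzMap (Rn n) ℂ
  ψ : SchwartzMap (Rn n) ℂ
  ft_pos : ∀ ξ : Rn n, 1 / 2 < ‖ξ‖ → ‖ξ‖ < 2 →
    0 < (FTn (⇑φ) ξ).re ∧ (FTn (⇑φ) ξ).im = 0
  ft_supp : ∀ ξ : Rn n, ¬(1 / 2 < ‖ξ‖ ∧ ‖ξ‖ < 2) → FTn (⇑φ) ξ = 0
  ft_sum : ∀ ξ : Rn n, ξ ≠ 0 → ∑' i : ℤ, FTn (⇑φ) (((2 : ℝ) ^ (-i)) • ξ) = 1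
  ft_psi : ∀ ξ : Rn n,
    FTn (⇑ψ) ξ = 1 - ∑' i : ℕ, FTn (⇑φ) (((2 : ℝ) ^ (-((i : ℤ) + 1))) • ξ)

/-- The dilate `φ′_i(x) = 2^{in} φ′(2^i x)`. -/
def lpPhin {n : ℕ} (P : LPFamily n) (i : ℕ) : Rn n → ℂ :=
  fun x => (((2 : ℝ) ^ (i * n) : ℝ) : ℂ) * P.φ (((2 : ℝ) ^ i) • x)

/-- Besov norm `B_{s,p}(f)` on `ℝⁿ`, `1 ≤ p < ∞`. -/
def besovN {n : ℕ} (P : LPFamily n) (s p : ℝ) (f : Rn n → ℂ) : ℝ≥0∞ :=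
  eLpNorm (convn (⇑P.ψ) f) (ENNReal.ofReal p) volume +
  (∑' i : ℕ,
    (ENNReal.ofReal ((2 : ℝ) ^ (s * ((i : ℝ) + 1))) *
      eLpNorm (convn (lpPhin P (i + 1)) f) (ENNReal.ofReal p) volume) ^ p) ^ (1 / p)

/-- The heat kernel `Γ(X,t)` on `ℝⁿ` (zero for `t ≤ 0`). -/
def heatKer (n : ℕ) (X : Rn n) (t : ℝ) : ℝ :=
  if 0 < t then (4 * π * t) ^ (-(n : ℝ) / 2) * Real.exp (-‖X‖ ^ 2 / (4 * t)) else 0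

/-- The heat extension `u(X,t) = ∫ Γ(X−Y,t) f(Y) dY`. -/
def heatExt {n : ℕ} (f : Rn n → ℂ) : Rn1 n → ℂ :=
  fun x => ∫ Y : Rn n, (heatKer n (x.1 - Y) x.2 : ℂ) * f Y

section HeatTrace

open Set Filter Topology
open scoped FourierTransform RealInnerProductSpace ContDiff SchwartzMap

/-- **Young's inequality** `L¹ * Lᵖ ⊆ Lᵖ`. -/
lemma eLpNorm_convn_le {n : ℕ} {p : ℝ} (hp : 1 ≤ p) {K g : Rn n → ℂ}
    (hK : Measurable K) (hg : Measurable g) :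
    eLpNorm (convn K g) (ENNReal.ofReal p) volume ≤
      (∫⁻ x, ‖K x‖ₑ) * eLpNorm g (ENNReal.ofReal p) volume := by
  have hp0 : 0 < p := by linarith
  have hp0' : ENNReal.ofReal p ≠ 0 := by simpa using hp0
  set A : ℝ≥0∞ := ∫⁻ x, ‖K x‖ₑ with hA
  have pointwise (x : Rn n) : ‖convn K g x‖ₑ ^ p ≤
      A ^ (p - 1) * ∫⁻ y, ‖K (x - y)‖ₑ * ‖g y‖ₑ ^ p := by
    have hmK : Measurable fun y => ‖K (x - y)‖ₑ := by fun_prop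
    set ν : Measure (Rn n) := volume.withDensity fun y => ‖K (x - y)‖ₑ with hν
    have hν1 : ν univ = A := by
      rw [hν, withDensity_apply _ MeasurableSet.univ, Measure.restrict_univ, hA]
      exact lintegral_sub_left_eq_self (fun y => ‖K y‖ₑ) x
    have h1 : ‖convn K g x‖ₑ ≤ eLpNorm' g 1 ν := by
      rw [eLpNorm', hν, lintegral_withDensity_eq_lintegral_mul₀ hmK.aemeasurable (by fun_prop)]
      refine (enorm_integral_le_lintegral_enorm _).trans (le_of_eq ?_)
      simp [enorm_mul]
    have h2 := eLpNorm'_le_eLpNorm'_mul_rpow_measure_univ (μ := ν) one_pos hp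
      hg.aestronglyMeasurable
    calc ‖convn K g x‖ₑ ^ p ≤ (eLpNorm' g p ν * ν univ ^ (1 / 1 - 1 / p)) ^ p :=
          ENNReal.rpow_le_rpow (h1.trans h2) hp0.le
      _ = _ := by
          rw [ENNReal.mul_rpow_of_nonneg _ _ hp0.le, ← ENNReal.rpow_mul, eLpNorm',
            ← ENNReal.rpow_mul, hν1, one_div_mul_cancel hp0.ne', ENNReal.rpow_one, mul_comm]
          congr 1
          · congr 1; field_simp
          · rw [hν, lintegral_withDensity_eq_lintegral_mul₀ hmK.aemeasurable (by fun_prop)]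
            rfl
  have key : ∫⁻ x, ‖convn K g x‖ₑ ^ p ≤ A ^ p * ∫⁻ y, ‖g y‖ₑ ^ p := by
    calc ∫⁻ x, ‖convn K g x‖ₑ ^ p
        ≤ ∫⁻ x, A ^ (p - 1) * ∫⁻ y, ‖K (x - y)‖ₑ * ‖g y‖ₑ ^ p := lintegral_mono pointwise
      _ = A ^ (p - 1) * ∫⁻ x, ∫⁻ y, ‖K (x - y)‖ₑ * ‖g y‖ₑ ^ p :=
          lintegral_const_mul _ (Measurable.lintegral_prod_right (by fun_prop))
      _ = A ^ (p - 1) * ∫⁻ y, ∫⁻ x, ‖K (x - y)‖ₑ * ‖g y‖ₑ ^ p := by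
          rw [lintegral_lintegral_swap]
          exact Measurable.aemeasurable (by fun_prop)
      _ = A ^ (p - 1) * ∫⁻ y, A * ‖g y‖ₑ ^ p := by
          congr 1
          refine lintegral_congr fun y => ?_
          rw [lintegral_mul_const _ (by fun_prop),
            lintegral_sub_right_eq_self (fun x => ‖K x‖ₑ) y]
      _ = A ^ p * ∫⁻ y, ‖g y‖ₑ ^ p := by
          rw [lintegral_const_mul _ (by fun_prop), ← mul_assoc]
          congr 1
          nth_rewrite 2 [← ENNReal.rpow_one A]
          rw [← ENNReal.rpow_add_of_nonneg _ _ (by linarith) zero_le_one]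
          simp
  rw [eLpNorm_eq_lintegral_rpow_enorm_toReal hp0' ENNReal.ofReal_ne_top,
    eLpNorm_eq_lintegral_rpow_enorm_toReal hp0' ENNReal.ofReal_ne_top,
    ENNReal.toReal_ofReal hp0.le]
  calc _ ≤ (A ^ p * ∫⁻ y, ‖g y‖ₑ ^ p) ^ (1 / p) := ENNReal.rpow_le_rpow key (by positivity)
    _ = _ := by
      rw [ENNReal.mul_rpow_of_nonneg _ _ (by positivity), ← ENNReal.rpow_mul,
        mul_one_div_cancel hp0.ne', ENNReal.rpow_one]

/-- Convolving an inverse Fourier integral with `K` multiplies its density by `𝓕 K`. -/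
lemma convn_fourierInv {n : ℕ} {K h : Rn n → ℂ} (hK : Integrable K) (hh : Integrable h) :
    convn K (𝓕⁻ h) = 𝓕⁻ (fun ξ => 𝓕 K ξ * h ξ) := by
  ext x
  have hint : Integrable (Function.uncurry fun (y ξ : Rn n) =>
      K (x - y) * (Real.fourierChar ⟪ξ, y⟫ • h ξ)) (volume.prod volume) := by
    have h0 : Integrable (fun z : Rn n × Rn n => K (x - z.1) * h z.2) (volume.prod volume) :=
      (hK.comp_sub_left x).mul_prod hh
    refine (h0.bdd_mul (c := 1)
      (f := fun z : Rn n × Rn n => (Real.fourierChar ⟪z.2, z.1⟫ : ℂ)) ?_ ?_).congr ?_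
    · exact Continuous.aestronglyMeasurable (by fun_prop)
    · exact .of_forall fun z => (Circle.norm_coe _).le
    · exact .of_forall fun z => by simp [Function.uncurry, Circle.smul_def]; ring
  simp only [convn, Real.fourierInv_eq]
  calc ∫ y, K (x - y) * ∫ ξ, Real.fourierChar ⟪ξ, y⟫ • h ξ
      = ∫ y, ∫ ξ, K (x - y) * (Real.fourierChar ⟪ξ, y⟫ • h ξ) := by
        simp_rw [integral_const_mul]
    _ = ∫ ξ, ∫ y, K (x - y) * (Real.fourierChar ⟪ξ, y⟫ • h ξ) := integral_integral_swap hint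
    _ = _ := by
        refine integral_congr_ae (.of_forall fun ξ => ?_)
        simp only
        rw [Real.fourier_eq,
          ← integral_sub_left_eq_self (fun v => Real.fourierChar (-⟪v, ξ⟫) • K v) volume x,
          ← integral_mul_const, Circle.smul_def, ← integral_smul]
        refine integral_congr_ae (.of_forall fun y => ?_)
        have hphase : Real.fourierChar ⟪ξ, y⟫ =
            Real.fourierChar ⟪ξ, x⟫ * Real.fourierChar (-⟪x - y, ξ⟫) := by
          rw [← AddChar.map_add_eq_mul, inner_sub_left, real_inner_comm ξ x, real_inner_comm ξ y]
          congr 1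
          ring
        simp only [Circle.smul_def, smul_eq_mul, hphase, Circle.coe_mul]
        ring

/-- The Fourier symbol `−4π²|ξ|²` of the Laplacian. -/
def lapSym {n : ℕ} (ξ : Rn n) : ℝ := -(4 * π ^ 2 * ‖ξ‖ ^ 2)

/-- The function `Δᵏ e^{tΔ} f`, where `h = 𝓕 f`. -/
def caloric {n : ℕ} (k : ℕ) (h : Rn n → ℂ) (x : Rn1 n) : ℂ :=
  𝓕⁻ (fun ξ => ((lapSym ξ ^ k * Real.exp (x.2 * lapSym ξ) : ℝ) : ℂ) * h ξ) x.1

lemma lapSym_nonpos {n : ℕ} (ξ : Rn n) : lapSym ξ ≤ 0 := by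
  unfold lapSym; rw [neg_nonpos]; positivity

lemma contDiff_lapSym {n : ℕ} : ContDiff ℝ ∞ (lapSym (n := n)) := by
  unfold lapSym
  exact (contDiff_const.mul (contDiff_norm_sq ℝ)).neg

@[fun_prop]
lemma continuous_lapSym {n : ℕ} : Continuous (lapSym (n := n)) := contDiff_lapSym.continuous

lemma norm_lapSym {n : ℕ} (ξ : Rn n) : ‖lapSym ξ‖ = 4 * π ^ 2 * ‖ξ‖ ^ 2 := by
  rw [lapSym, norm_neg, Real.norm_of_nonneg (by positivity)]

lemma exp_mul_lapSym_le_one {n : ℕ} {t : ℝ} (ht : 0 ≤ t) (ξ : Rn n) :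
    Real.exp (t * lapSym ξ) ≤ 1 :=
  Real.exp_le_one_iff.2 (mul_nonpos_of_nonneg_of_nonpos ht (lapSym_nonpos ξ))

lemma integrable_caloric_density {n : ℕ} (k : ℕ) (h : 𝓢(Rn n, ℂ)) {t : ℝ} (ht : 0 ≤ t) :
    Integrable fun ξ => ((lapSym ξ ^ k * Real.exp (t * lapSym ξ) : ℝ) : ℂ) * h ξ := by
  refine ((h.integrable_pow_mul volume (2 * k)).const_mul ((4 * π ^ 2) ^ k)).mono'
    (Continuous.aestronglyMeasurable (by fun_prop)) (.of_forall fun ξ => ?_)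
  rw [norm_mul, Complex.norm_real, norm_mul, norm_pow, norm_lapSym, mul_pow, ← pow_mul,
    Real.norm_of_nonneg (Real.exp_pos _).le]
  calc _ ≤ (4 * π ^ 2) ^ k * ‖ξ‖ ^ (2 * k) * 1 * ‖h ξ‖ := by
        gcongr; exact exp_mul_lapSym_le_one ht ξ
    _ = _ := by ring

/-- The derivative in `(X, t)` of the phase of the caloric plane wave of frequency `ξ`. -/
def phaseDeriv {n : ℕ} (ξ : Rn n) : Rn1 n →L[ℝ] ℂ :=
  (2 * (π : ℂ) * Complex.I) • (Complex.ofRealCLM ∘L innerSL ℝ ξ ∘L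
    ContinuousLinearMap.fst ℝ (Rn n) ℝ) +
  (lapSym ξ : ℂ) • (Complex.ofRealCLM ∘L ContinuousLinearMap.snd ℝ (Rn n) ℝ)

lemma continuous_phaseDeriv {n : ℕ} : Continuous (phaseDeriv (n := n)) := by
  unfold phaseDeriv
  fun_prop

lemma norm_phaseDeriv_le {n : ℕ} (ξ : Rn n) :
    ‖phaseDeriv ξ‖ ≤ 2 * π * ‖ξ‖ + 4 * π ^ 2 * ‖ξ‖ ^ 2 := by
  refine ContinuousLinearMap.opNorm_le_bound _ (by positivity) fun x => ?_
  have h1 : ‖(2 * (π : ℂ) * Complex.I) * ((⟪ξ, x.1⟫ : ℝ) : ℂ)‖ ≤ 2 * π * ‖ξ‖ * ‖x‖ := by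
    rw [norm_mul, Complex.norm_real]
    have := (norm_inner_le_norm (𝕜 := ℝ) ξ x.1).trans
      (mul_le_mul_of_nonneg_left (norm_fst_le x) (norm_nonneg ξ))
    simp only [norm_mul, Complex.norm_ofNat, Complex.norm_real, Complex.norm_I, mul_one,
      Real.norm_of_nonneg Real.pi_pos.le]
    rw [mul_assoc _ ‖ξ‖]
    gcongr
  have h2 : ‖(lapSym ξ : ℂ) * (x.2 : ℂ)‖ ≤ 4 * π ^ 2 * ‖ξ‖ ^ 2 * ‖x‖ := by
    rw [norm_mul, Complex.norm_real, Complex.norm_real, norm_lapSym]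
    gcongr
    exact norm_snd_le x
  rw [add_mul]
  exact (norm_add_le _ _).trans (add_le_add h1 h2)

lemma caloric_eq {n : ℕ} (k : ℕ) (h : Rn n → ℂ) (x : Rn1 n) :
    caloric k h x = ∫ ξ, Complex.exp (phaseDeriv ξ x) * ((lapSym ξ ^ k : ℝ) * h ξ) := by
  rw [caloric, Real.fourierInv_eq']
  refine integral_congr_ae (.of_forall fun ξ => ?_)
  simp only [phaseDeriv, add_apply, smul_apply,
    ContinuousLinearMap.comp_apply, Complex.exp_add, smul_eq_mul]
  simp
  ring_nf

lemma norm_exp_phaseDeriv {n : ℕ} (ξ : Rn n) (x : Rn1 n) :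
    ‖Complex.exp (phaseDeriv ξ x)‖ = Real.exp (x.2 * lapSym ξ) := by
  rw [Complex.norm_exp]
  congr 1
  simp [phaseDeriv, mul_comm]

/-- The derivative in `(X, t)` of the integrand of `caloric k h`. -/
def caloricDerivDensity {n : ℕ} (k : ℕ) (h : Rn n → ℂ) (x : Rn1 n) (ξ : Rn n) :
    Rn1 n →L[ℝ] ℂ :=
  ((lapSym ξ ^ k : ℝ) * h ξ) • Complex.exp (phaseDeriv ξ x) • phaseDeriv ξ

lemma continuous_caloricDerivDensity {n : ℕ} (k : ℕ) (h : 𝓢(Rn n, ℂ)) (x : Rn1 n) :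
    Continuous (caloricDerivDensity k h x) := by
  have hcont := continuous_phaseDeriv (n := n)
  unfold caloricDerivDensity
  fun_prop

/-- A majorant, uniform in `t ≥ 0`, of `caloricDerivDensity`. -/
def caloricDerivBound {n : ℕ} (k : ℕ) (h : Rn n → ℂ) (ξ : Rn n) : ℝ :=
  (4 * π ^ 2) ^ k * (2 * π) * (‖ξ‖ ^ (2 * k + 1) * ‖h ξ‖) +
    (4 * π ^ 2) ^ (k + 1) * (‖ξ‖ ^ (2 * k + 2) * ‖h ξ‖)

lemma integrable_caloricDerivBound {n : ℕ} (k : ℕ) (h : 𝓢(Rn n, ℂ)) :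
    Integrable (caloricDerivBound k h) :=
  ((h.integrable_pow_mul volume _).const_mul _).add ((h.integrable_pow_mul volume _).const_mul _)

lemma norm_caloricDerivDensity_le {n : ℕ} (k : ℕ) (h : Rn n → ℂ) {x : Rn1 n} (hx : 0 < x.2)
    (ξ : Rn n) : ‖caloricDerivDensity k h x ξ‖ ≤ caloricDerivBound k h ξ := by
  rw [caloricDerivDensity, norm_smul, norm_smul, norm_exp_phaseDeriv, norm_mul,
    Complex.norm_real, norm_pow, norm_lapSym, mul_pow, ← pow_mul, caloricDerivBound]
  calc _ ≤ (4 * π ^ 2) ^ k * ‖ξ‖ ^ (2 * k) * ‖h ξ‖ *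
        (1 * (2 * π * ‖ξ‖ + 4 * π ^ 2 * ‖ξ‖ ^ 2)) := by
        gcongr
        · exact exp_mul_lapSym_le_one hx.le ξ
        · exact norm_phaseDeriv_le ξ
    _ = _ := by ring

lemma integrable_caloricDerivDensity {n : ℕ} (k : ℕ) (h : 𝓢(Rn n, ℂ)) {x : Rn1 n}
    (hx : 0 < x.2) : Integrable (caloricDerivDensity k h x) :=
  (integrable_caloricDerivBound k h).mono'
    (continuous_caloricDerivDensity k h x).aestronglyMeasurable
    (.of_forall (norm_caloricDerivDensity_le k h hx))

lemma hasFDerivAt_caloric {n : ℕ} (k : ℕ) (h : 𝓢(Rn n, ℂ)) {x : Rn1 n} (hx : 0 < x.2) :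
    HasFDerivAt (caloric k h) (∫ ξ, caloricDerivDensity k h x ξ) x := by
  have hcont := continuous_phaseDeriv (n := n)
  rw [funext (caloric_eq k h)]
  refine hasFDerivAt_integral_of_dominated_of_fderiv_le
    ((isOpen_lt continuous_const continuous_snd).mem_nhds hx) ?_ ?_
    (continuous_caloricDerivDensity k h x).aestronglyMeasurable
    (.of_forall fun ξ y hy => norm_caloricDerivDensity_le k h hy ξ)
    (integrable_caloricDerivBound k h) (.of_forall fun ξ y _ => ?_)
  · exact .of_forall fun y => Continuous.aestronglyMeasurable (by fun_prop)
  · refine (integrable_caloric_density k h hx.le).mono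
      (Continuous.aestronglyMeasurable (by fun_prop)) (.of_forall fun ξ => ?_)
    rw [norm_mul, norm_exp_phaseDeriv, norm_mul, norm_mul, Complex.norm_real, Complex.norm_real,
      norm_mul, Real.norm_of_nonneg (Real.exp_pos _).le]
    exact le_of_eq (by ring)
  · exact (phaseDeriv ξ).hasFDerivAt.cexp.mul_const _

lemma continuousAt_caloric {n : ℕ} (k : ℕ) (h : 𝓢(Rn n, ℂ)) {x : Rn1 n} (hx : 0 < x.2) :
    ContinuousAt (caloric k h) x :=
  (hasFDerivAt_caloric k h hx).continuousAt

lemma dT_caloric {n : ℕ} (k : ℕ) (h : 𝓢(Rn n, ℂ)) {x : Rn1 n} (hx : 0 < x.2) :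
    dT (caloric k h) x = caloric (k + 1) h x := by
  rw [dT, (hasFDerivAt_caloric k h hx).fderiv, caloric_eq, ContinuousLinearMap.integral_apply]
  · refine integral_congr_ae (.of_forall fun ξ => ?_)
    have : phaseDeriv ξ (0, 1) = lapSym ξ := by simp [phaseDeriv]
    simp only [caloricDerivDensity, smul_apply, this, smul_eq_mul]
    push_cast
    ring
  · exact integrable_caloricDerivDensity k h hx

lemma iterate_dT_eq_caloric {n : ℕ} {u : Rn1 n → ℂ} {h : 𝓢(Rn n, ℂ)}
    (hu : ∀ x : Rn1 n, 0 < x.2 → u x = caloric 0 h x) (k : ℕ) {x : Rn1 n} (hx : 0 < x.2) :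
    dT^[k] u x = caloric k h x := by
  induction k generalizing x with
  | zero => exact hu x hx
  | succ k ih =>
    rw [Function.iterate_succ_apply', ← dT_caloric k h hx, dT, dT]
    congr 1
    refine Filter.EventuallyEq.fderiv_eq ?_
    filter_upwards [(isOpen_lt continuous_const continuous_snd).mem_nhds hx] with y hy
    exact ih hy

section HeatKernel

variable {n : ℕ}

lemma heatKer_nonneg (X : Rn n) (t : ℝ) : 0 ≤ heatKer n X t := by
  unfold heatKer; split_ifs <;> positivity

lemma ofReal_heatKer {t : ℝ} (ht : 0 < t) :
    (fun X : Rn n => (heatKer n X t : ℂ)) = fun X =>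
      (((4 * π * t) ^ (-(n : ℝ) / 2) : ℝ) : ℂ) *
        Complex.exp (-((1 / (4 * t) : ℝ) : ℂ) * ‖X‖ ^ 2) := by
  ext X
  rw [heatKer, if_pos ht]
  push_cast
  congr 2
  ring

lemma integrable_heatKer {t : ℝ} (ht : 0 < t) :
    Integrable fun X : Rn n => (heatKer n X t : ℂ) := by
  rw [ofReal_heatKer ht]
  refine Integrable.const_mul ?_ _
  have hb : 0 < ((1 / (4 * t) : ℝ) : ℂ).re := by rw [Complex.ofReal_re]; positivity
  simpa using GaussianFourier.integrable_cexp_neg_mul_sq_norm_add hb 0 (0 : Rn n)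

lemma fourier_heatKer {t : ℝ} (ht : 0 < t) (ξ : Rn n) :
    𝓕 (fun X : Rn n => (heatKer n X t : ℂ)) ξ = (Real.exp (t * lapSym ξ) : ℂ) := by
  have hb : 0 < ((1 / (4 * t) : ℝ) : ℂ).re := by rw [Complex.ofReal_re]; positivity
  have hc : (((4 * π * t) ^ (-(n : ℝ) / 2) : ℝ) : ℂ) *
      ((π : ℂ) / ((1 / (4 * t) : ℝ) : ℂ)) ^ ((n : ℂ) / 2) = 1 := by
    have h1 : (π : ℂ) / ((1 / (4 * t) : ℝ) : ℂ) = ((4 * π * t : ℝ) : ℂ) := by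
      push_cast; field_simp
    have h2 : ((n : ℂ) / 2) = (((n : ℝ) / 2 : ℝ) : ℂ) := by push_cast; rfl
    rw [h1, h2, ← Complex.ofReal_cpow (by positivity), ← Complex.ofReal_mul,
      ← Real.rpow_add (by positivity)]
    simp [neg_div]
  have h := fourier_gaussian_innerProductSpace hb ξ
  rw [finrank_euclideanSpace_fin, Real.fourier_eq'] at h
  rw [ofReal_heatKer ht, Real.fourier_eq']
  simp_rw [smul_eq_mul, mul_left_comm _ (((4 * π * t) ^ (-(n : ℝ) / 2) : ℝ) : ℂ)]
  simp_rw [smul_eq_mul] at h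
  rw [integral_const_mul, h, ← mul_assoc, hc, one_mul, lapSym]
  push_cast
  congr 1
  field_simp

lemma lintegral_enorm_heatKer {t : ℝ} (ht : 0 < t) :
    ∫⁻ X : Rn n, ‖(heatKer n X t : ℂ)‖ₑ = 1 := by
  have h := fourier_heatKer ht (0 : Rn n)
  simp only [Real.fourier_eq, inner_zero_right, neg_zero, AddChar.map_zero_eq_one, one_smul,
    lapSym, norm_zero] at h
  rw [integral_complex_ofReal] at h
  norm_num at h
  have hi : Integrable fun X : Rn n => heatKer n X t := by
    simpa using (integrable_heatKer (n := n) ht).re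
  rw [← ENNReal.ofReal_one, ← h,
    ofReal_integral_eq_lintegral_ofReal hi (.of_forall fun X => heatKer_nonneg X t)]
  refine lintegral_congr fun X => ?_
  rw [← ofReal_norm, Complex.norm_real, Real.norm_of_nonneg (heatKer_nonneg X t)]

lemma measurable_heatKer {t : ℝ} (ht : 0 < t) :
    Measurable fun X : Rn n => (heatKer n X t : ℂ) := by
  rw [ofReal_heatKer ht]
  fun_prop

lemma heatExt_eq_caloric (f : 𝓢(Rn n, ℂ)) {x : Rn1 n} (hx : 0 < x.2) :
    heatExt f x = caloric 0 (𝓕 f : 𝓢(Rn n, ℂ)) x := by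
  have hf : (f : Rn n → ℂ) = 𝓕⁻ ((𝓕 f : 𝓢(Rn n, ℂ)) : Rn n → ℂ) := by
    rw [← SchwartzMap.fourierInv_coe, FourierTransform.fourierInv_fourier_eq]
  have h := congrFun (convn_fourierInv (integrable_heatKer hx)
    (𝓕 f : 𝓢(Rn n, ℂ)).integrable) x.1
  rw [← hf] at h
  refine h.trans ?_
  simp only [caloric, fourier_heatKer hx, pow_zero, one_mul]

lemma caloric_semigroup (k : ℕ) (h : 𝓢(Rn n, ℂ)) {r t : ℝ} (hr : 0 ≤ r) (hrt : r < t) :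
    (fun X => caloric k h (X, t)) =
      convn (fun X => (heatKer n X (t - r) : ℂ)) fun X => caloric k h (X, r) := by
  have hrt' : 0 < t - r := sub_pos.2 hrt
  refine Eq.trans ?_
    (convn_fourierInv (integrable_heatKer hrt') (integrable_caloric_density k h hr)).symm
  ext X
  simp only [caloric, fourier_heatKer hrt']
  refine congrArg (fun F : Rn n → ℂ => 𝓕⁻ F X) (funext fun ξ => ?_)
  rw [← mul_assoc, ← Complex.ofReal_mul, mul_left_comm, ← Real.exp_add]
  ring_nf

lemma measurable_caloric (k : ℕ) (h : 𝓢(Rn n, ℂ)) {t : ℝ} (ht : 0 < t) :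
    Measurable fun X : Rn n => caloric k h (X, t) := by
  refine (continuous_iff_continuousAt.2 fun X => ?_).measurable
  exact (continuousAt_caloric k h (x := (X, t)) ht).comp
    (f := fun X : Rn n => (X, t)) (by fun_prop)

lemma eLpNorm_caloric_antitoneOn {p : ℝ} (hp : 1 ≤ p) (k : ℕ) (h : 𝓢(Rn n, ℂ)) :
    AntitoneOn (fun t => eLpNorm (fun X => caloric k h (X, t)) (ENNReal.ofReal p) volume)
      (Ioi 0) := by
  intro r hr t _ hrt
  rcases hrt.eq_or_lt with rfl | hrt
  · rfl
  have := eLpNorm_convn_le hp (measurable_heatKer (n := n) (sub_pos.2 hrt))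
    (measurable_caloric k h hr)
  rwa [← caloric_semigroup k h (le_of_lt hr) hrt, lintegral_enorm_heatKer (sub_pos.2 hrt),
    one_mul] at this

end HeatKernel

section Dilation

variable {n : ℕ}

lemma fourier_comp_smul_eq (K : Rn n → ℂ) {c : ℝ} (hc : 0 < c) (ξ : Rn n) :
    𝓕 (fun x => K (c • x)) ξ = (((c ^ n)⁻¹ : ℝ) : ℂ) * 𝓕 K (c⁻¹ • ξ) := by
  rw [Real.fourier_eq, Real.fourier_eq]
  have h := Measure.integral_comp_smul_of_nonneg (volume : Measure (Rn n))
    (fun v => Real.fourierChar (-⟪v, c⁻¹ • ξ⟫) • K v) c (hR := hc.le)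
  rw [finrank_euclideanSpace_fin, Complex.real_smul] at h
  rw [← h]
  refine integral_congr_ae (.of_forall fun x => ?_)
  simp only [inner_smul_left, inner_smul_right, conj_trivial]
  rw [inv_mul_cancel_left₀ hc.ne']

lemma lintegral_enorm_comp_smul (K : 𝓢(Rn n, ℂ)) {a c : ℝ} (ha : 0 ≤ a) (hc : 0 < c) :
    ∫⁻ x, ‖(a : ℂ) * K (c • x)‖ₑ = ENNReal.ofReal (a * (c ^ n)⁻¹ * ∫ x, ‖K x‖) := by
  have hi : Integrable fun x => (a : ℂ) * K (c • x) :=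
    (K.integrable.comp_smul hc.ne').const_mul _
  rw [← ofReal_integral_norm_eq_lintegral_enorm hi]
  simp only [norm_mul, Complex.norm_real, Real.norm_of_nonneg ha]
  rw [integral_const_mul, Measure.integral_comp_smul_of_nonneg volume (fun x => ‖K x‖) c
      (hR := hc.le),
    finrank_euclideanSpace_fin, smul_eq_mul, mul_assoc]

lemma lapSym_smul (c : ℝ) (ξ : Rn n) : lapSym (c • ξ) = c ^ 2 * lapSym ξ := by
  rw [lapSym, lapSym, norm_smul, mul_pow, Real.norm_eq_abs, sq_abs]
  ring

/-- Multipliers supported in a ball, and away from the origin if `k ≠ 0`, factor through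
`Δᵏ e^{sΔ}`. -/
lemma exists_caloric_factorization (k : ℕ) (s : ℝ) (φ : 𝓢(Rn n, ℂ))
    (hball : ∀ ξ, 2 ≤ ‖ξ‖ → 𝓕 (φ : Rn n → ℂ) ξ = 0)
    (hzero : k = 0 ∨ ∀ ξ, ‖ξ‖ ≤ 1 / 2 → 𝓕 (φ : Rn n → ℂ) ξ = 0) :
    ∃ K : 𝓢(Rn n, ℂ), ∀ ξ, 𝓕 (φ : Rn n → ℂ) ξ =
      𝓕 (K : Rn n → ℂ) ξ * ((lapSym ξ ^ k * Real.exp (s * lapSym ξ) : ℝ) : ℂ) := by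
  set M : Rn n → ℂ := fun ξ =>
    𝓕 (φ : Rn n → ℂ) ξ * (((lapSym ξ ^ k)⁻¹ * Real.exp (-(s * lapSym ξ)) : ℝ) : ℂ) with hM
  have hlap : ContDiff ℝ ∞ (lapSym (n := n)) := contDiff_lapSym
  have hφ : ContDiff ℝ ∞ (𝓕 (φ : Rn n → ℂ)) := (𝓕 φ : 𝓢(Rn n, ℂ)).smooth ⊤
  have hlap_ne {ξ : Rn n} (hξ : ξ ≠ 0) : lapSym ξ ≠ 0 := by
    have := norm_pos_iff.2 hξ
    rw [lapSym, neg_ne_zero]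
    positivity
  have hsmooth : ContDiff ℝ ∞ M := by
    refine contDiff_iff_contDiffAt.2 fun ξ => ?_
    have hregular (hne : lapSym ξ ^ k ≠ 0) : ContDiffAt ℝ ∞ M ξ := by
      refine hφ.contDiffAt.mul (Complex.ofRealCLM.contDiff.contDiffAt.comp ξ ?_)
      exact ((hlap.pow k).contDiffAt.inv hne).mul
        (Real.contDiff_exp.comp (contDiff_const.mul hlap).neg).contDiffAt
    rcases hzero with rfl | hzero
    · exact hregular (by simp)
    by_cases hξ : ‖ξ‖ < 1 / 2
    · refine (contDiffAt_const (c := (0 : ℂ))).congr_of_eventuallyEq ?_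
      filter_upwards [(isOpen_lt continuous_norm continuous_const).mem_nhds hξ] with η hη
      rw [hM]
      simp only [hzero η (le_of_lt hη), zero_mul]
    · refine hregular (pow_ne_zero _ (hlap_ne fun h => hξ ?_))
      rw [h, norm_zero]
      norm_num
  have hcompact : HasCompactSupport M := by
    refine HasCompactSupport.intro (isCompact_closedBall 0 2) fun ξ hξ => ?_
    rw [mem_closedBall_zero_iff, not_le] at hξ
    rw [hM]
    simp only [hball ξ hξ.le, zero_mul]
  refine ⟨𝓕⁻ (hcompact.toSchwartzMap hsmooth), fun ξ => ?_⟩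
  rw [← SchwartzMap.fourier_coe (𝓕⁻ (hcompact.toSchwartzMap hsmooth)),
    FourierTransform.fourier_fourierInv_eq]
  change _ = 𝓕 (φ : Rn n → ℂ) ξ * _ * _
  rcases eq_or_ne (lapSym ξ ^ k) 0 with h0 | h0
  · have hξ : ξ = 0 := by
      by_contra h
      exact pow_ne_zero k (hlap_ne h) h0
    rcases hzero with rfl | hzero
    · simp at h0
    · rw [hzero ξ (by rw [hξ, norm_zero]; norm_num)]
      simp
  · rw [mul_assoc, ← Complex.ofReal_mul, Real.exp_neg]
    have : (lapSym ξ ^ k)⁻¹ * (Real.exp (s * lapSym ξ))⁻¹ *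
        (lapSym ξ ^ k * Real.exp (s * lapSym ξ)) = 1 := by
      field_simp
    rw [this, Complex.ofReal_one, mul_one]

lemma eLpNorm_convn_dilate_le {p : ℝ} (hp : 1 ≤ p) {k : ℕ} {s : ℝ} (hs : 0 < s)
    {φ K : 𝓢(Rn n, ℂ)} (hK : ∀ ξ, 𝓕 (φ : Rn n → ℂ) ξ =
      𝓕 (K : Rn n → ℂ) ξ * ((lapSym ξ ^ k * Real.exp (s * lapSym ξ) : ℝ) : ℂ))
    {c : ℝ} (hc : 0 < c) (f : 𝓢(Rn n, ℂ)) :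
    eLpNorm (convn (fun x => ((c ^ n : ℝ) : ℂ) * φ (c • x)) f) (ENNReal.ofReal p) volume ≤
      ENNReal.ofReal ((c ^ (2 * k))⁻¹ * ∫ x, ‖K x‖) *
        eLpNorm (fun X => caloric k (𝓕 f : 𝓢(Rn n, ℂ)) (X, s / c ^ 2)) (ENNReal.ofReal p)
          volume := by
  have hs' : 0 < s / c ^ 2 := by positivity
  have hcn : (c ^ n : ℝ) ≠ 0 := by positivity
  set a : ℝ := (c ^ (2 * k))⁻¹ * c ^ n with ha
  have hconv : convn (fun x => ((c ^ n : ℝ) : ℂ) * φ (c • x)) f =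
      convn (fun x => (a : ℂ) * K (c • x))
        fun X => caloric k (𝓕 f : 𝓢(Rn n, ℂ)) (X, s / c ^ 2) := by
    have hf : (f : Rn n → ℂ) = 𝓕⁻ ((𝓕 f : 𝓢(Rn n, ℂ)) : Rn n → ℂ) := by
      rw [← SchwartzMap.fourierInv_coe, FourierTransform.fourierInv_fourier_eq]
    have hscale (b : ℂ) (L : 𝓢(Rn n, ℂ)) (ξ : Rn n) :
        𝓕 (fun x => b * L (c • x)) ξ =
          b * ((((c ^ n)⁻¹ : ℝ) : ℂ) * 𝓕 (L : Rn n → ℂ) (c⁻¹ • ξ)) := by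
      rw [← fourier_comp_smul_eq (L : Rn n → ℂ) hc ξ, Real.fourier_eq', Real.fourier_eq',
        ← integral_const_mul]
      refine integral_congr_ae (.of_forall fun x => ?_)
      simp only [smul_eq_mul]
      ring
    have hint (b : ℂ) (L : 𝓢(Rn n, ℂ)) : Integrable fun x => b * L (c • x) :=
      (L.integrable.comp_smul hc.ne').const_mul _
    nth_rewrite 1 [hf]
    rw [convn_fourierInv (hint _ φ) (𝓕 f : 𝓢(Rn n, ℂ)).integrable]
    refine Eq.trans ?_ (convn_fourierInv (hint _ K)
      (integrable_caloric_density k (𝓕 f : 𝓢(Rn n, ℂ)) hs'.le)).symm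
    refine congrArg (fun F : Rn n → ℂ => 𝓕⁻ F) (funext fun ξ => ?_)
    have hsym : lapSym (c⁻¹ • ξ) ^ k * Real.exp (s * lapSym (c⁻¹ • ξ)) =
        (c ^ (2 * k))⁻¹ * (lapSym ξ ^ k * Real.exp (s / c ^ 2 * lapSym ξ)) := by
      rw [lapSym_smul, mul_pow, ← pow_mul, inv_pow, mul_assoc, inv_pow]
      congr 3
      field_simp
    rw [hscale, hscale, hK, hsym, ha]
    push_cast
    ring
  rw [hconv]
  have hmeas : Measurable fun x => (a : ℂ) * K (c • x) :=
    Continuous.measurable (by fun_prop)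
  refine (eLpNorm_convn_le hp hmeas (measurable_caloric k (𝓕 f : 𝓢(Rn n, ℂ)) hs')).trans
    (le_of_eq ?_)
  rw [lintegral_enorm_comp_smul K (by positivity) hc, ha, mul_inv_cancel_right₀ hcn]

end Dilation

section Trace

variable {n : ℕ}

lemma tSet_ofReal (T : ℝ) : tSet (ENNReal.ofReal T) = Ioo 0 T := by
  ext t
  simp only [tSet, mem_ofPred_eq, mem_Ioo]
  exact and_congr_right fun ht => ENNReal.ofReal_lt_ofReal_iff_of_nonneg ht.le

/-- The `p`-th power of the strip norm of `D_t^k u`, sliced in time. -/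
lemma lintegral_slices_rpow_eq {p : ℝ} (hp : 1 ≤ p) (T : ℝ) (k : ℕ) (f : 𝓢(Rn n, ℂ)) :
    (∫⁻ t in Ioo 0 T, eLpNorm (fun X => caloric k (𝓕 f : 𝓢(Rn n, ℂ)) (X, t))
      (ENNReal.ofReal p) volume ^ p) ^ (1 / p) =
      eLpNorm (dT^[k] (heatExt f)) (ENNReal.ofReal p) (stripMeasure n (ENNReal.ofReal T)) := by
  have hp0 : 0 < p := by linarith
  have hp0' : ENNReal.ofReal p ≠ 0 := by simpa using hp0
  set h : 𝓢(Rn n, ℂ) := 𝓕 f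
  have hstrip : {x : Rn1 n | x.2 ∈ tSet (ENNReal.ofReal T)} = univ ×ˢ Ioo 0 T := by
    ext x
    simp [tSet_ofReal]
  have hmeas : MeasurableSet ((univ : Set (Rn n)) ×ˢ Ioo 0 T) :=
    MeasurableSet.univ.prod measurableSet_Ioo
  have hcongr : dT^[k] (heatExt f) =ᵐ[stripMeasure n (ENNReal.ofReal T)] caloric k h := by
    rw [stripMeasure, hstrip]
    filter_upwards [ae_restrict_mem hmeas] with x hx
    exact iterate_dT_eq_caloric (fun y hy => heatExt_eq_caloric f hy) k hx.2.1
  have hcont : ContinuousOn (caloric k h) (univ ×ˢ Ioo 0 T) := fun x hx =>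
    (continuousAt_caloric k h hx.2.1).continuousWithinAt
  have hae : AEMeasurable (fun x => ‖caloric k h x‖ₑ ^ p)
      (volume.prod (volume.restrict (Ioo 0 T))) := by
    have := (hcont.aemeasurable (μ := volume) hmeas).enorm.pow_const p
    rwa [Measure.volume_eq_prod, ← Measure.prod_restrict, Measure.restrict_univ] at this
  rw [eLpNorm_congr_ae hcongr, eLpNorm_eq_lintegral_rpow_enorm_toReal hp0' ENNReal.ofReal_ne_top,
    ENNReal.toReal_ofReal hp0.le, stripMeasure, hstrip, Measure.volume_eq_prod,
    ← Measure.prod_restrict, Measure.restrict_univ, lintegral_prod_symm _ hae]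
  congr 1
  refine lintegral_congr fun t => ?_
  rw [eLpNorm_eq_lintegral_rpow_enorm_toReal hp0' ENNReal.ofReal_ne_top,
    ENNReal.toReal_ofReal hp0.le, ← ENNReal.rpow_mul, one_div_mul_cancel hp0.ne',
    ENNReal.rpow_one]

lemma eLpNorm_dT_le_wNorm {i l : ℕ} (hl : l ≤ i) (p : ℝ) (T : ℝ≥0∞) (g : Rn1 n → ℂ) :
    eLpNorm (dT^[l] g) (ENNReal.ofReal p) (stripMeasure n T) ≤ wNorm i p T g := by
  have h0 : dXmulti (0 : Fin n → ℕ) (dT^[l] g) = dT^[l] g := by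
    unfold dXmulti
    generalize List.finRange n = L
    induction L with
    | nil => rfl
    | cons a L => simp
  unfold wNorm
  refine le_trans ?_ (Finset.single_le_sum (fun _ _ => zero_le)
    (Finset.mem_range.2 (Nat.lt_succ_of_le hl)))
  refine le_trans (le_of_eq ?_) (Finset.single_le_sum (fun _ _ => zero_le)
    (show (0 : Fin n → ℕ) ∈ _ from ?_))
  · rw [h0]
  · simp [hl]

lemma mul_ofReal_sub_le_lintegral_Ioo {A : ℝ → ℝ≥0∞} (hA : AntitoneOn A (Ioi 0)) {r t : ℝ}
    (hr : 0 ≤ r) (hrt : r < t) : A t * ENNReal.ofReal (t - r) ≤ ∫⁻ s in Ioo r t, A s := by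
  rw [← Real.volume_Ioo, ← setLIntegral_const]
  exact setLIntegral_mono' measurableSet_Ioo fun s hs =>
    hA (hr.trans_lt hs.1) (hr.trans_lt hrt) hs.2.le

/-- The dyadic sum of a decreasing function is controlled by its integral. -/
lemma tsum_dyadic_le_lintegral {A : ℝ → ℝ≥0∞} (hA : AntitoneOn A (Ioi 0)) {T : ℝ} (hT : 0 < T) :
    ∑' j : ℕ, ENNReal.ofReal (4⁻¹ ^ (j + 1)) * A (4⁻¹ ^ (j + 1) * T) ≤
      ENNReal.ofReal (4 / (3 * T)) * ∫⁻ t in Ioo 0 T, A t := by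
  set τ : ℕ → ℝ := fun j => 4⁻¹ ^ (j + 1) * T with hτ
  have hτpos (j : ℕ) : 0 < τ j := by positivity
  have hτsucc (j : ℕ) : τ (j + 1) = 4⁻¹ * τ j := by simp only [hτ]; ring
  have hanti : Antitone τ := antitone_nat_of_succ_le fun j => by
    rw [hτsucc]; linarith [hτpos j]
  have hdisj : Pairwise (Function.onFun Disjoint fun j => Ioo (τ (j + 1)) (τ j)) :=
    hanti.pairwise_disjoint_on_Ioo_succ
  have hterm (j : ℕ) : ENNReal.ofReal (4⁻¹ ^ (j + 1)) * A (τ j) ≤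
      ENNReal.ofReal (4 / (3 * T)) * ∫⁻ t in Ioo (τ (j + 1)) (τ j), A t := by
    have h := mul_ofReal_sub_le_lintegral_Ioo hA (hτpos (j + 1)).le
      (show τ (j + 1) < τ j by rw [hτsucc]; linarith [hτpos j])
    refine le_trans (le_of_eq ?_) (mul_le_mul_right h _)
    rw [mul_comm (A _), ← mul_assoc, ← ENNReal.ofReal_mul (by positivity), hτsucc]
    congr 2
    simp only [hτ]
    field_simp
    ring
  calc _ ≤ ∑' j, ENNReal.ofReal (4 / (3 * T)) * ∫⁻ t in Ioo (τ (j + 1)) (τ j), A t :=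
        ENNReal.tsum_le_tsum hterm
    _ = ENNReal.ofReal (4 / (3 * T)) * ∫⁻ t in ⋃ j, Ioo (τ (j + 1)) (τ j), A t := by
        rw [ENNReal.tsum_mul_left, lintegral_iUnion (fun j => measurableSet_Ioo) hdisj]
    _ ≤ _ := by
        refine mul_le_mul_right (lintegral_mono_set (iUnion_subset fun j t ht => ?_)) _
        refine ⟨(hτpos _).trans ht.1, ht.2.trans_le ?_⟩
        exact mul_le_of_le_one_left hT.le (pow_le_one₀ (by norm_num) (by norm_num))

lemma FTn_eq_fourier (f : Rn n → ℂ) : FTn f = 𝓕 f := by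
  ext ξ
  rw [FTn, Real.fourier_eq']
  refine integral_congr_ae (.of_forall fun x => ?_)
  simp only [PiLp.inner_apply, smul_eq_mul]
  congr 2
  push_cast
  simp [mul_comm]
  ring

lemma LPFamily.fourier_phi_eq_zero (P : LPFamily n) {ξ : Rn n}
    (hξ : ‖ξ‖ ≤ 1 / 2 ∨ 2 ≤ ‖ξ‖) : 𝓕 (P.φ : Rn n → ℂ) ξ = 0 := by
  rw [← FTn_eq_fourier]
  refine P.ft_supp ξ fun h => ?_
  rcases hξ with hξ | hξ <;> linarith [h.1, h.2]

lemma LPFamily.fourier_psi_eq_zero (P : LPFamily n) {ξ : Rn n} (hξ : 2 ≤ ‖ξ‖) :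
    𝓕 (P.ψ : Rn n → ℂ) ξ = 0 := by
  have hξ0 : ξ ≠ 0 := by
    rintro rfl
    norm_num at hξ
  have hsum := P.ft_sum ξ hξ0
  have hlow (i : ℤ) (hi : i ≤ 0) : FTn P.φ ((2 : ℝ) ^ (-i) • ξ) = 0 := by
    rw [FTn_eq_fourier]
    refine P.fourier_phi_eq_zero (.inr ?_)
    rw [norm_smul, norm_zpow, Real.norm_ofNat]
    have := one_le_zpow₀ (a := (2 : ℝ)) one_le_two (show 0 ≤ -i by omega)
    nlinarith
  have hinj : Function.Injective fun i : ℕ => (i : ℤ) + 1 := fun a b h => by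
    simpa using h
  have hsupp : Function.support (fun i : ℤ => FTn P.φ ((2 : ℝ) ^ (-i) • ξ)) ⊆
      range fun i : ℕ => (i : ℤ) + 1 := by
    intro i hi
    have hi0 : 0 < i := by
      by_contra h
      exact hi (hlow i (by omega))
    exact ⟨(i - 1).toNat, by simp only; omega⟩
  rw [← FTn_eq_fourier, P.ft_psi, ← hsum, ← hinj.tsum_eq hsupp, sub_self]

end Trace

section BesovBound

variable {n : ℕ}

lemma antitoneOn_eLpNorm_rpow {p : ℝ} (hp : 1 ≤ p) (k : ℕ) (h : 𝓢(Rn n, ℂ)) :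
    AntitoneOn (fun t => eLpNorm (fun X => caloric k h (X, t)) (ENNReal.ofReal p) volume ^ p)
      (Ioi 0) := fun _ ha _ hb hab =>
  ENNReal.rpow_le_rpow (eLpNorm_caloric_antitoneOn hp k h ha hb hab) (by linarith)

lemma exists_low_frequency_bound {p : ℝ} (hp : 1 ≤ p) {T : ℝ} (hT : 0 < T) (i : ℕ)
    (P : LPFamily n) :
    ∃ C : ℝ≥0∞, C ≠ ⊤ ∧ ∀ f : 𝓢(Rn n, ℂ),
      eLpNorm (convn P.ψ f) (ENNReal.ofReal p) volume ≤
        C * wNorm i p (ENNReal.ofReal T) (heatExt f) := by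
  have hp0 : 0 < p := by linarith
  obtain ⟨K, hK⟩ := exists_caloric_factorization 0 (T / 2) P.ψ
    (fun ξ hξ => P.fourier_psi_eq_zero hξ) (.inl rfl)
  refine ⟨ENNReal.ofReal (∫ x, ‖K x‖) * ENNReal.ofReal (2 / T) ^ (1 / p),
    ENNReal.mul_ne_top ENNReal.ofReal_ne_top
      (ENNReal.rpow_ne_top_of_nonneg (by positivity) ENNReal.ofReal_ne_top), fun f => ?_⟩
  have h := eLpNorm_convn_dilate_le hp (half_pos hT) hK one_pos f
  simp only [one_pow, Complex.ofReal_one, one_mul, one_smul, inv_one, div_one] at h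
  refine h.trans ?_
  rw [mul_assoc]
  gcongr
  refine le_trans ?_ (mul_le_mul_right
    ((lintegral_slices_rpow_eq hp T 0 f).le.trans (eLpNorm_dT_le_wNorm i.zero_le p _ _)) _)
  rw [← ENNReal.mul_rpow_of_nonneg _ _ (by positivity), ← ENNReal.rpow_le_rpow_iff hp0,
    ← ENNReal.rpow_mul, one_div_mul_cancel hp0.ne', ENNReal.rpow_one]
  have hA := mul_ofReal_sub_le_lintegral_Ioo
    (antitoneOn_eLpNorm_rpow hp 0 (𝓕 f : 𝓢(Rn n, ℂ))) le_rfl (half_pos hT)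
  refine le_trans (le_of_eq ?_) (mul_le_mul_right (hA.trans
    (lintegral_mono_set (Ioo_subset_Ioo_right (half_le_self hT.le)))) _)
  rw [mul_left_comm, ← ENNReal.ofReal_mul (by positivity), sub_zero,
    show 2 / T * (T / 2) = 1 by field_simp, ENNReal.ofReal_one,
    mul_one]

lemma exists_high_frequency_bound {p : ℝ} (hp : 1 ≤ p) {T : ℝ} (hT : 0 < T) (i : ℕ)
    (P : LPFamily n) :
    ∃ C : ℝ≥0∞, C ≠ ⊤ ∧ ∀ f : 𝓢(Rn n, ℂ),
      (∑' j : ℕ, (ENNReal.ofReal ((2 : ℝ) ^ ((2 * (i : ℝ) - 2 / p) * ((j : ℝ) + 1))) *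
        eLpNorm (convn (lpPhin P (j + 1)) f) (ENNReal.ofReal p) volume) ^ p) ^ (1 / p) ≤
        C * wNorm i p (ENNReal.ofReal T) (heatExt f) := by
  have hp0 : 0 < p := by linarith
  obtain ⟨K, hK⟩ := exists_caloric_factorization i T P.φ
    (fun ξ hξ => P.fourier_phi_eq_zero (.inr hξ))
    (.inr fun ξ hξ => P.fourier_phi_eq_zero (.inl hξ))
  set B : ℝ := ∫ x, ‖K x‖ with hB
  have hB0 : 0 ≤ B := integral_nonneg fun x => norm_nonneg _
  refine ⟨ENNReal.ofReal B * ENNReal.ofReal (4 / (3 * T)) ^ (1 / p),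
    ENNReal.mul_ne_top ENNReal.ofReal_ne_top
      (ENNReal.rpow_ne_top_of_nonneg (by positivity) ENNReal.ofReal_ne_top), fun f => ?_⟩
  set A : ℝ → ℝ≥0∞ := fun t => eLpNorm (fun X => caloric i (𝓕 f : 𝓢(Rn n, ℂ)) (X, t))
    (ENNReal.ofReal p) volume with hA
  have hblock (j : ℕ) :
      (ENNReal.ofReal ((2 : ℝ) ^ ((2 * (i : ℝ) - 2 / p) * ((j : ℝ) + 1))) *
        eLpNorm (convn (lpPhin P (j + 1)) f) (ENNReal.ofReal p) volume) ^ p ≤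
      ENNReal.ofReal B ^ p *
        (ENNReal.ofReal (4⁻¹ ^ (j + 1)) * A (4⁻¹ ^ (j + 1) * T) ^ p) := by
    have h := eLpNorm_convn_dilate_le hp hT hK (c := 2 ^ (j + 1)) (by positivity) f
    rw [← pow_mul] at h
    have htime : T / ((2 : ℝ) ^ (j + 1)) ^ 2 = 4⁻¹ ^ (j + 1) * T := by
      rw [← pow_mul, mul_comm (j + 1), pow_mul, inv_pow]
      norm_num
      field_simp
    have hweight : (2 : ℝ) ^ ((2 * (i : ℝ) - 2 / p) * ((j : ℝ) + 1)) *
        ((((2 : ℝ) ^ (j + 1)) ^ (2 * i))⁻¹ * B) = B * (4⁻¹ ^ (j + 1)) ^ (1 / p) := by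
      have h4 : (4⁻¹ : ℝ) = 2 ^ (-2 : ℝ) := by norm_num [Real.rpow_neg]
      have h1 : ((4⁻¹ : ℝ) ^ (j + 1)) ^ (1 / p) = 2 ^ (-2 * ((j : ℝ) + 1) * (1 / p)) := by
        rw [h4, ← Real.rpow_natCast, ← Real.rpow_mul two_pos.le, ← Real.rpow_mul two_pos.le]
        push_cast
        rfl
      have h2 : (((2 : ℝ) ^ (j + 1)) ^ (2 * i))⁻¹ = 2 ^ (-(((j : ℝ) + 1) * (2 * i))) := by
        rw [← pow_mul, Real.rpow_neg two_pos.le, ← Real.rpow_natCast]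
        push_cast
        rfl
      rw [h1, h2, ← mul_assoc, ← Real.rpow_add two_pos, mul_comm B]
      congr 2
      ring
    calc _ ≤ (ENNReal.ofReal ((2 : ℝ) ^ ((2 * (i : ℝ) - 2 / p) * ((j : ℝ) + 1))) *
          (ENNReal.ofReal ((((2 : ℝ) ^ (j + 1)) ^ (2 * i))⁻¹ * B) *
            A (T / ((2 : ℝ) ^ (j + 1)) ^ 2))) ^ p := by
          refine ENNReal.rpow_le_rpow (mul_le_mul_right h _) hp0.le
      _ = (ENNReal.ofReal B * ENNReal.ofReal ((4⁻¹ ^ (j + 1)) ^ (1 / p)) *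
            A (4⁻¹ ^ (j + 1) * T)) ^ p := by
          rw [← mul_assoc, ← ENNReal.ofReal_mul (by positivity), hweight, htime,
            ENNReal.ofReal_mul hB0]
      _ = _ := by
          rw [ENNReal.mul_rpow_of_nonneg _ _ hp0.le, ENNReal.mul_rpow_of_nonneg _ _ hp0.le,
            mul_assoc, ENNReal.ofReal_rpow_of_nonneg (p := p)
              (x := (4⁻¹ ^ (j + 1)) ^ (1 / p)) (by positivity) hp0.le,
            ← Real.rpow_mul (by positivity), one_div_mul_cancel hp0.ne', Real.rpow_one]
  have hsum := tsum_dyadic_le_lintegral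
    (antitoneOn_eLpNorm_rpow hp i (𝓕 f : 𝓢(Rn n, ℂ))) hT
  calc _ ≤ (ENNReal.ofReal B ^ p * (ENNReal.ofReal (4 / (3 * T)) *
        ∫⁻ t in Ioo 0 T, A t ^ p)) ^ (1 / p) := by
        refine ENNReal.rpow_le_rpow ((ENNReal.tsum_le_tsum hblock).trans ?_) (by positivity)
        rw [ENNReal.tsum_mul_left]
        exact mul_le_mul_right hsum _
    _ = ENNReal.ofReal B * ENNReal.ofReal (4 / (3 * T)) ^ (1 / p) *
        (∫⁻ t in Ioo 0 T, A t ^ p) ^ (1 / p) := by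
        rw [ENNReal.mul_rpow_of_nonneg _ _ (by positivity),
          ENNReal.mul_rpow_of_nonneg _ _ (by positivity), ← ENNReal.rpow_mul,
          mul_one_div_cancel hp0.ne', ENNReal.rpow_one, mul_assoc]
    _ ≤ _ := mul_le_mul_right
        ((lintegral_slices_rpow_eq hp T i f).le.trans (eLpNorm_dT_le_wNorm le_rfl p _ _)) _

end BesovBound

end HeatTrace

/-- `B_{2i−2/p,p}(f) ≲ ‖u‖_{W^{2i,i}_p(ℝⁿ_T)}` for the heat extension `u`. -/
theorem stmt17 (n : ℕ) (hn : 1 ≤ n) (p : ℝ) (hp : 1 ≤ p) (T : ℝ) (hT : 0 < T) (i : ℕ)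
    (P : LPFamily n) :
    ∃ C : ℝ, 0 < C ∧
      ∀ f : SchwartzMap (Rn n) ℂ,
        besovN P (2 * (i : ℝ) - 2 / p) p ⇑f
          ≤ ENNReal.ofReal C * wNorm i p (ENNReal.ofReal T) (heatExt ⇑f) := by
  obtain ⟨C₁, hC₁, h₁⟩ := exists_low_frequency_bound hp hT i P
  obtain ⟨C₂, hC₂, h₂⟩ := exists_high_frequency_bound hp hT i P
  refine ⟨(C₁ + C₂).toReal + 1, by positivity, fun f => ?_⟩
  calc besovN P (2 * (i : ℝ) - 2 / p) p ⇑f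
      ≤ (C₁ + C₂) * wNorm i p (ENNReal.ofReal T) (heatExt ⇑f) := by
        rw [add_mul]
        exact add_le_add (h₁ f) (h₂ f)
    _ ≤ _ := by
        gcongr
        refine ENNReal.le_ofReal_iff_toReal_le (ENNReal.add_ne_top.2 ⟨hC₁, hC₂⟩)
          (by positivity) |>.2 (by linarith)
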